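/- arXiv:2507.03195 — 3 statements merged into one kernel-verified Lean document; each statement's English description precedes it below -/
import Mathlib

section
/- Fix a countable group Γ and p ∈ ℕ. Let E(Γ) be the set of equivalence relations on Γ, viewed as subsets of Γ × Γ with the topology of pointwise convergence of indicator functions. There is a map φ : Prob(p^Γ) × E(Γ) → Prob(p^Γ) such that: (1) φ is continuous; (2) φ(ω, Γ × Γ) = ω for all ω ∈ Prob(p^Γ); and (3) γˢ_*φ(ω, E) = φ(γˢ_*ω, γᵈ·E) for all γ ∈ Γ, ω ∈ Prob(p^Γ), and E ∈ E(Γ). Indeed, the map φ(ω, E) = ∏_{C ∈ Γ/E} (π_C)_*ω has these properties, where for C ⊆ Γ, π_C : p^Γ → p^C is the coordinate projection and the product measure over the E-classes C (which partition Γ) is identified with a Borel probability measure on p^Γ. -/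
open MeasureTheory

namespace Stmt6

variable (Γ : Type*) [Group Γ] [Countable Γ] (p : ℕ)

/-- The compact space `p^Γ = {0, …, p−1}^Γ` with the product topology. -/
abbrev PGam := Γ → Fin p

/-- The space `E(Γ)` of equivalence relations on `Γ`, viewed as subsets of `Γ × Γ`
(via indicator functions), with the topology of pointwise convergence. -/
def ERel := {E : Γ × Γ → Bool // Equivalence (fun a b : Γ => E (a, b) = true)}

instance : TopologicalSpace (ERel Γ) :=
  inferInstanceAs (TopologicalSpace {E : Γ × Γ → Bool // Equivalence (fun a b : Γ => E (a, b) = true)})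

/-- The left shift `γˢ : p^Γ → p^Γ`, `(γˢ·x)(δ) = x(γ⁻¹δ)`. -/
def sAct (γ : Γ) (x : PGam Γ p) : PGam Γ p := fun δ => x (γ⁻¹ * δ)

lemma measurable_sAct (γ : Γ) : Measurable (sAct Γ p γ) :=
  measurable_pi_lambda _ fun _ => measurable_pi_apply _

/-- The diagonal action of `Γ` on `E(Γ)`. -/
def dActE (γ : Γ) (E : ERel Γ) : ERel Γ :=
  ⟨fun q => E.1 (γ⁻¹ * q.1, γ⁻¹ * q.2),
    ⟨fun _ => E.2.refl _, fun h => E.2.symm h, fun h h' => E.2.trans h h'⟩⟩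

/-- The indiscrete equivalence relation `Γ × Γ`. -/
def topERel : ERel Γ :=
  ⟨fun _ => true, ⟨fun _ => rfl, fun _ => rfl, fun _ _ => rfl⟩⟩

/-- a canonical representative of the class of `a` -/
noncomputable def rep {Γ : Type*} (E : ERel Γ) (a : Γ) : Γ :=
  (Quotient.mk (⟨fun a b => E.1 (a, b) = true, E.2⟩ : Setoid Γ) a).out

theorem rep_eq_iff {Γ : Type*} (E : ERel Γ) (a b : Γ) : rep E a = rep E b ↔ E.1 (a, b) = true := by
  unfold rep
  rw [Quotient.out_inj]
  exact Quotient.eq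

/-- the gluing map -/
def glue {Γ : Type*} {p : ℕ} (r : Γ → Γ) (y : Γ → PGam Γ p) : PGam Γ p := fun δ => y (r δ) δ

theorem measurable_glue {Γ : Type*} {p : ℕ} (r : Γ → Γ) :
    Measurable (glue (p := p) r) :=
  measurable_pi_lambda _ fun δ => (measurable_pi_apply δ).comp (measurable_pi_apply (r δ))

/-- the map `φ` -/
noncomputable def phi {Γ : Type*} {p : ℕ} (ω : ProbabilityMeasure (PGam Γ p)) (E : ERel Γ) :
    ProbabilityMeasure (PGam Γ p) :=
  ⟨(Measure.infinitePi (fun _ : Γ => (ω : Measure (PGam Γ p)))).map (glue (rep E)),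
    Measure.isProbabilityMeasure_map (measurable_glue _).aemeasurable⟩

theorem clopen_cyl {Γ : Type*} {p : ℕ} (D : Finset Γ) (A : Γ → Set (Fin p)) :
    IsClopen {x : PGam Γ p | ∀ γ ∈ D, x γ ∈ A γ} := by
  have : {x : PGam Γ p | ∀ γ ∈ D, x γ ∈ A γ} = ⋂ γ ∈ D, (fun x : PGam Γ p => x γ) ⁻¹' (A γ) := by
    ext x; simp
  rw [this]
  exact isClopen_biInter_finset fun γ _ => (isClopen_discrete _).preimage (continuous_apply γ)

theorem meas_cyl {Γ : Type*} {p : ℕ} (D : Finset Γ) (A : Γ → Set (Fin p)) :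
    MeasurableSet {x : PGam Γ p | ∀ γ ∈ D, x γ ∈ A γ} := by
  have : {x : PGam Γ p | ∀ γ ∈ D, x γ ∈ A γ} = ⋂ γ ∈ D, (fun x : PGam Γ p => x γ) ⁻¹' (A γ) := by
    ext x; simp
  rw [this]
  exact D.measurableSet_biInter fun γ _ => measurable_pi_apply γ (Set.toFinite _).measurableSet

theorem cyl_filter {Γ : Type*} {p : ℕ} (E : ERel Γ) (γ : Γ) (D : Finset Γ) (A : Γ → Set (Fin p)) :
    {x : PGam Γ p | ∀ δ ∈ D, E.1 (γ, δ) = true → x δ ∈ A δ} =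
      {x : PGam Γ p | ∀ δ ∈ D.filter (fun δ => E.1 (γ, δ) = true), x δ ∈ A δ} := by
  ext x; simp

theorem phi_cyl {Γ : Type*} {p : ℕ} (ω : ProbabilityMeasure (PGam Γ p)) (E : ERel Γ)
    (D R : Finset Γ) (A : Γ → Set (Fin p)) (hRD : R ⊆ D)
    (hR : ∀ δ ∈ D, ∃! γ : Γ, γ ∈ R ∧ E.1 (γ, δ) = true) :
    (phi ω E : Measure (PGam Γ p)) {x : PGam Γ p | ∀ γ ∈ D, x γ ∈ A γ} =
      ∏ γ ∈ R, (ω : Measure (PGam Γ p))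
        {x : PGam Γ p | ∀ δ ∈ D, E.1 (γ, δ) = true → x δ ∈ A δ} := by
  classical
  change (Measure.infinitePi (fun _ : Γ => (ω : Measure (PGam Γ p)))).map (glue (rep E)) _ = _
  rw [Measure.map_apply (measurable_glue _) (meas_cyl D A)]
  have hinj : Set.InjOn (rep E) R := by
    intro a ha b hb hab
    rw [rep_eq_iff] at hab
    exact (hR b (hRD hb)).unique ⟨ha, hab⟩ ⟨hb, E.2.refl b⟩
  have hset : glue (rep E) ⁻¹' {x : PGam Γ p | ∀ γ ∈ D, x γ ∈ A γ} =
      Set.pi (R.image (rep E) : Finset Γ)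
        (fun c => {x : PGam Γ p | ∀ δ ∈ D, rep E δ = c → x δ ∈ A δ}) := by
    ext y
    simp only [Set.mem_preimage, Set.mem_ofPred_eq, Set.mem_pi, Finset.mem_coe, glue]
    constructor
    · rintro h c - δ hδ rfl
      exact h δ hδ
    · intro h δ hδ
      obtain ⟨γ, ⟨hγ, hE⟩, -⟩ := hR δ hδ
      exact h _ (Finset.mem_image.2 ⟨γ, hγ, (rep_eq_iff E _ _).2 hE⟩) δ hδ rfl
  have key : ∀ c, {x : PGam Γ p | ∀ δ ∈ D, rep E δ = c → x δ ∈ A δ} =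
      {x : PGam Γ p | ∀ δ ∈ D.filter (fun δ => rep E δ = c), x δ ∈ A δ} := by
    intro c; ext x; simp
  rw [hset, Measure.infinitePi_pi _ (fun c _ => by rw [key]; exact meas_cyl _ _),
    Finset.prod_image hinj]
  refine Finset.prod_congr rfl fun γ _ => ?_
  congr 1
  ext x
  simp only [Set.mem_ofPred_eq]
  refine forall₂_congr fun δ _ => ?_
  rw [eq_comm, rep_eq_iff]

theorem exists_R {Γ : Type*} (E : ERel Γ) (D : Finset Γ) :
    ∃ R ⊆ D, ∀ δ ∈ D, ∃! γ : Γ, γ ∈ R ∧ E.1 (γ, δ) = true := by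
  classical
  obtain ⟨R, hRD, hinj, him⟩ := Finset.exists_subset_injOn_image_eq_of_surjOn
    (f := rep E) (D : Set Γ) (D.image (rep E)) (by simpa using Set.surjOn_image _ _)
  refine ⟨R, by exact_mod_cast hRD, fun δ hδ => ?_⟩
  have : rep E δ ∈ R.image (rep E) := him ▸ Finset.mem_image_of_mem _ hδ
  obtain ⟨γ, hγ, h⟩ := Finset.mem_image.1 this
  refine ⟨γ, ⟨hγ, (rep_eq_iff E _ _).1 h⟩, fun c hc => hinj hc.1 hγ ?_⟩
  rw [h, rep_eq_iff]; exact hc.2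

/-- the cylinders -/
def cyls (Γ : Type*) (p : ℕ) : Set (Set (PGam Γ p)) :=
  squareCylinders fun _ => {s : Set (Fin p) | MeasurableSet s}

theorem mem_cyls {Γ : Type*} {p : ℕ} {s : Set (PGam Γ p)} (h : s ∈ cyls Γ p) :
    ∃ (D : Finset Γ) (A : Γ → Set (Fin p)), s = {x : PGam Γ p | ∀ γ ∈ D, x γ ∈ A γ} := by
  obtain ⟨D, A, -, rfl⟩ := h
  exact ⟨D, A, rfl⟩

theorem pi_cyls (Γ : Type*) (p : ℕ) : IsPiSystem (cyls Γ p) :=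
  isPiSystem_squareCylinders (fun _ => MeasurableSpace.isPiSystem_measurableSet) (by simp)

theorem ext_cyl {Γ : Type*} {p : ℕ} {μ ν : ProbabilityMeasure (PGam Γ p)}
    (h : ∀ (D : Finset Γ) (A : Γ → Set (Fin p)),
      (μ : Measure (PGam Γ p)) {x : PGam Γ p | ∀ γ ∈ D, x γ ∈ A γ} =
      (ν : Measure (PGam Γ p)) {x : PGam Γ p | ∀ γ ∈ D, x γ ∈ A γ}) : μ = ν := by
  apply Subtype.ext
  have i1 : IsFiniteMeasure (μ : Measure (PGam Γ p)) := inferInstance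
  change (μ : Measure (PGam Γ p)) = (ν : Measure (PGam Γ p))
  refine ext_of_generate_finite (cyls Γ p) generateFrom_squareCylinders.symm (pi_cyls Γ p) ?_ ?_
  · intro s hs
    obtain ⟨D, A, rfl⟩ := mem_cyls hs
    exact h D A
  · have h1 := measure_univ (μ := (μ : Measure (PGam Γ p)))
    have h2 := measure_univ (μ := (ν : Measure (PGam Γ p)))
    exact h1.trans h2.symm

theorem phi_top {Γ : Type*} [Group Γ] {p : ℕ} (ω : ProbabilityMeasure (PGam Γ p)) :
    phi ω (topERel Γ) = ω := by
  apply Subtype.ext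
  change (Measure.infinitePi (fun _ : Γ => (ω : Measure (PGam Γ p)))).map
    (glue (rep (topERel Γ))) = ω
  have : glue (p := p) (rep (topERel Γ)) = Function.eval (rep (topERel Γ) 1) := by
    funext y δ
    have : rep (topERel Γ) δ = rep (topERel Γ) 1 := (rep_eq_iff _ _ _).2 rfl
    simp [glue, this]
  rw [this]
  exact Measure.infinitePi_map_eval _ _

theorem phi_equiv {Γ : Type*} [Group Γ] [Countable Γ] {p : ℕ} (γ : Γ) (ω : ProbabilityMeasure (PGam Γ p))
    (E : ERel Γ) :
    (phi ω E).map (measurable_sAct Γ p γ).aemeasurable =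
      phi (ω.map (measurable_sAct Γ p γ).aemeasurable) (dActE Γ γ E) := by
  classical
  apply ext_cyl
  intro D A
  obtain ⟨R, hRD, hR⟩ := exists_R (dActE Γ γ E) D
  rw [phi_cyl _ _ D R A hRD hR]
  simp only [ProbabilityMeasure.toMeasure_map]
  rw [Measure.map_apply (measurable_sAct Γ p γ) (meas_cyl D A)]
  have h1 : sAct Γ p γ ⁻¹' {x : PGam Γ p | ∀ γ ∈ D, x γ ∈ A γ} =
      {x : PGam Γ p | ∀ δ ∈ D.image (fun δ => γ⁻¹ * δ), x δ ∈ A (γ * δ)} := by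
    ext x
    simp only [Set.mem_preimage, Set.mem_ofPred_eq, Finset.forall_mem_image, sAct,
      mul_inv_cancel_left]
  rw [h1, phi_cyl ω E (D.image (fun δ => γ⁻¹ * δ)) (R.image (fun δ => γ⁻¹ * δ))
    (fun δ => A (γ * δ)) (Finset.image_subset_image hRD) ?_]
  · rw [Finset.prod_image (fun a _ b _ h => mul_left_cancel h)]
    refine Finset.prod_congr rfl fun c _ => ?_
    rw [cyl_filter (dActE Γ γ E), Measure.map_apply (measurable_sAct Γ p γ) (meas_cyl _ A)]
    congr 1
    ext x
    simp only [Set.mem_preimage, Set.mem_ofPred_eq, Finset.forall_mem_image, sAct,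
      mul_inv_cancel_left]
    constructor
    · intro h d hd
      obtain ⟨hd, hE⟩ := Finset.mem_filter.1 hd
      exact h hd hE
    · intro h d hd hE
      exact h d (Finset.mem_filter.2 ⟨hd, hE⟩)
  · intro δ hδ
    obtain ⟨d, hd, rfl⟩ := Finset.mem_image.1 hδ
    obtain ⟨c, ⟨hc, hE⟩, hu⟩ := hR d hd
    refine ⟨γ⁻¹ * c, ⟨Finset.mem_image_of_mem _ hc, hE⟩, ?_⟩
    rintro c' ⟨hc', hE'⟩
    obtain ⟨c'', hc'', rfl⟩ := Finset.mem_image.1 hc'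
    rw [hu c'' ⟨hc'', hE'⟩]

open Filter Topology in
theorem phi_cont {Γ : Type*} [Countable Γ] {p : ℕ} :
    Continuous (fun q : ProbabilityMeasure (PGam Γ p) × ERel Γ => phi q.1 q.2) := by
  have : FirstCountableTopology (ERel Γ) :=
    (⟨rfl⟩ : Topology.IsInducing (fun E : ERel Γ => E.1)).firstCountableTopology
  rw [continuous_iff_continuousAt]
  rintro ⟨ω, E⟩
  refine (pi_cyls Γ p).tendsto_probabilityMeasure_of_tendsto_of_mem ?_ ?_ ?_
  · intro s hs
    obtain ⟨D, A, rfl⟩ := mem_cyls hs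
    exact meas_cyl D A
  · intro u hu x hx
    obtain ⟨I, t, ht, hsub⟩ := isOpen_pi_iff.1 hu x hx
    refine ⟨(I : Set Γ).pi t, ⟨I, t, fun i _ => (Set.toFinite (t i)).measurableSet, rfl⟩, ?_, hsub⟩
    exact set_pi_mem_nhds I.finite_toSet fun i hi => (ht i hi).1.mem_nhds (ht i hi).2
  · intro s hs
    obtain ⟨D, A, rfl⟩ := mem_cyls hs
    obtain ⟨R, hRD, hR⟩ := exists_R E D
    have hval : ∀ (ω' : ProbabilityMeasure (PGam Γ p)) (E' : ERel Γ),
        (∀ a ∈ D, ∀ b ∈ D, E'.1 (a, b) = E.1 (a, b)) →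
        phi ω' E' {x : PGam Γ p | ∀ γ ∈ D, x γ ∈ A γ} = ∏ γ ∈ R, ω'
          {x : PGam Γ p | ∀ δ ∈ D, E.1 (γ, δ) = true → x δ ∈ A δ} := by
      intro ω' E' hE'
      have hR' : ∀ δ ∈ D, ∃! γ : Γ, γ ∈ R ∧ E'.1 (γ, δ) = true := by
        intro δ hδ
        obtain ⟨c, ⟨hc, hcE⟩, hu⟩ := hR δ hδ
        refine ⟨c, ⟨hc, by rw [hE' c (hRD hc) δ hδ]; exact hcE⟩, fun c' hc' => hu c' ⟨hc'.1, ?_⟩⟩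
        rw [← hE' c' (hRD hc'.1) δ hδ]; exact hc'.2
      have := phi_cyl ω' E' D R A hRD hR'
      apply ENNReal.coe_injective
      push_cast
      rw [ProbabilityMeasure.ennreal_coeFn_eq_coeFn_toMeasure, this]
      refine Finset.prod_congr rfl fun c hc => ?_
      rw [ProbabilityMeasure.ennreal_coeFn_eq_coeFn_toMeasure]
      congr 1
      ext x
      simp only [Set.mem_ofPred_eq]
      refine forall₂_congr fun δ hδ => ?_
      rw [hE' c (hRD hc) δ hδ]
    have hev : ∀ᶠ q : ProbabilityMeasure (PGam Γ p) × ERel Γ in 𝓝 (ω, E),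
        ∀ a ∈ D, ∀ b ∈ D, q.2.1 (a, b) = E.1 (a, b) := by
      rw [Filter.eventually_all_finset]
      intro a _
      rw [Filter.eventually_all_finset]
      intro b _
      have hc : Continuous (fun q : ProbabilityMeasure (PGam Γ p) × ERel Γ => q.2.1 (a, b)) :=
        (continuous_apply (a, b)).comp
          ((continuous_subtype_val (p := fun E : Γ × Γ → Bool =>
            Equivalence (fun a b : Γ => E (a, b) = true))).comp continuous_snd)
      have := hc.continuousAt (x := (ω, E))
      exact this.eventually (p := fun z => z = E.1 (a, b)) (by simp [nhds_discrete])
    rw [hval ω E (fun _ _ _ _ => rfl)]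
    refine Tendsto.congr' (hev.mono fun q hq => (hval q.1 q.2 hq).symm) ?_
    refine tendsto_finsetProd _ fun c _ => ?_
    rw [cyl_filter]
    exact ProbabilityMeasure.tendsto_measure_of_isClopen_of_tendsto
      (continuous_fst.tendsto (ω, E)) (clopen_cyl _ A)

/-- There is a map `φ : Prob(p^Γ) × E(Γ) → Prob(p^Γ)` which is
(1) continuous, (2) satisfies `φ(ω, Γ × Γ) = ω`, and (3) is equivariant:
`γˢ_*φ(ω, E) = φ(γˢ_*ω, γᵈ·E)`.  Indeed `φ(ω, E) = ∏_{C ∈ Γ/E} (π_C)_*ω` works, i.e.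
`φ` can moreover be chosen to satisfy the finite-dimensional product formula below. -/
theorem stmt6 :
    ∃ φ : ProbabilityMeasure (PGam Γ p) → ERel Γ → ProbabilityMeasure (PGam Γ p),
      -- (1) continuity
      Continuous (fun q : ProbabilityMeasure (PGam Γ p) × ERel Γ => φ q.1 q.2) ∧
      -- (2) the indiscrete relation gives back `ω`
      (∀ ω, φ ω (topERel Γ) = ω) ∧
      -- (3) equivariance
      (∀ (γ : Γ) (ω : ProbabilityMeasure (PGam Γ p)) (E : ERel Γ),
        (φ ω E).map (measurable_sAct Γ p γ).aemeasurable =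
          φ (ω.map (measurable_sAct Γ p γ).aemeasurable) (dActE Γ γ E)) ∧
      -- the product formula: `φ(ω, E) = ∏_{C ∈ Γ/E} (π_C)_*ω`, expressed on cylinder sets
      (∀ (ω : ProbabilityMeasure (PGam Γ p)) (E : ERel Γ)
        (D R : Finset Γ) (A : Γ → Set (Fin p)), R ⊆ D →
        (∀ δ ∈ D, ∃! γ : Γ, γ ∈ R ∧ E.1 (γ, δ) = true) →
        (φ ω E : Measure (PGam Γ p)) {x : PGam Γ p | ∀ γ ∈ D, x γ ∈ A γ} =
          ∏ γ ∈ R, (ω : Measure (PGam Γ p))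
            {x : PGam Γ p | ∀ δ ∈ D, E.1 (γ, δ) = true → x δ ∈ A δ}) := by
  exact ⟨phi, phi_cont, phi_top, phi_equiv, phi_cyl⟩

end Stmt6
end

section
/- Let Γ be a countable group and Λ ≤ Γ a subgroup. Let Γ ↷ (X, μ) and Λ ↷ (Y, ν) be p.m.p. actions on standard probability spaces, and let φ : Y → X be a Λ-equivariant factor map (i.e., φ is measurable, φ_*ν = μ, and φ(λ·y) = λ·φ(y) for every λ ∈ Λ and almost every y, where Λ acts on X by restriction of the Γ-action). Then there exists a p.m.p. action Γ ↷ (Ȳ, ν̄) and a measurable, measure-preserving, Λ-equivariant map π : Ȳ → Y such that the composition φ ∘ π : Ȳ → X is Γ-equivariant (almost everywhere). -/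
open MeasureTheory

universe u

namespace Stmt12

/-- A probability-measure-preserving action of a group `Γ` on `(X, μ)`. -/
structure PMPAction (Γ : Type*) [Group Γ] (X : Type*) [MeasurableSpace X]
    (μ : Measure X) where
  act : Γ → X → X
  measurePreserving : ∀ γ, MeasurePreserving (act γ) μ μ
  act_one : ∀ x, act 1 x = x
  act_mul : ∀ γ₁ γ₂ x, act (γ₁ * γ₂) x = act γ₁ (act γ₂ x)

open ProbabilityTheory in
/-- The kernel of infinite products of Markov kernels. -/
noncomputable def piKernel {Q X Y : Type*} [MeasurableSpace X] [MeasurableSpace Y]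
    (κ : Q → Kernel X Y) [∀ q, IsMarkovKernel (κ q)] : Kernel X (Q → Y) where
  toFun x := Measure.infinitePi (fun q => κ q x)
  measurable' := by
    refine Measurable.measure_of_isPiSystem_of_isProbabilityMeasure
      (generateFrom_squareCylinders (α := fun _ : Q => Y)).symm
      (isPiSystem_squareCylinders (fun _ => MeasurableSpace.isPiSystem_measurableSet)
        (fun _ => MeasurableSet.univ)) ?_
    rintro _ ⟨s, t, ht, rfl⟩
    have ht' : ∀ q, MeasurableSet (t q) := fun q => ht q trivial
    simp_rw [Measure.infinitePi_pi _ (fun q _ => ht' q)]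
    exact Finset.measurable_fun_prod _ fun q _ => Kernel.measurable_coe _ (ht' q)

open ProbabilityTheory in
lemma piKernel_apply {Q X Y : Type*} [MeasurableSpace X] [MeasurableSpace Y]
    (κ : Q → Kernel X Y) [∀ q, IsMarkovKernel (κ q)] (x : X) :
    piKernel κ x = Measure.infinitePi (fun q => κ q x) := rfl

open ProbabilityTheory in
instance {Q X Y : Type*} [MeasurableSpace X] [MeasurableSpace Y]
    (κ : Q → Kernel X Y) [∀ q, IsMarkovKernel (κ q)] : IsMarkovKernel (piKernel κ) :=
  ⟨fun x => by rw [piKernel_apply]; infer_instance⟩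

open ProbabilityTheory in
lemma map_infinitePi_reindex {Q Y : Type*} [MeasurableSpace Y]
    (P : Q → Measure Y) [∀ q, IsProbabilityMeasure (P q)] (σ : Q → Q)
    (hσ : Function.Injective σ) (f : Q → Y → Y) (hf : ∀ q, Measurable (f q)) :
    (Measure.infinitePi P).map (fun h q => f q (h (σ q))) =
      Measure.infinitePi (fun q => (P (σ q)).map (f q)) := by
  have h1 : (Measure.infinitePi P).map (fun h q => h (σ q)) =
      Measure.infinitePi (fun q => P (σ q)) :=
    Measure.map_infinitePi_infinitePi_of_inj hσ
  rw [← Measure.infinitePi_map_pi _ hf, ← h1, Measure.map_map (by fun_prop) (by fun_prop)]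
  rfl

open ProbabilityTheory in
/-- Equivariance of the disintegration. -/
lemma condDistrib_equivariant {X Y : Type*} [MeasurableSpace X]
    [MeasurableSpace Y] [StandardBorelSpace Y] [Nonempty Y]
    (ν : Measure Y) [IsProbabilityMeasure ν] (φ : Y → X) (hφ : Measurable φ)
    (S S' : X → X) (T T' : Y → Y)
    (hS : MeasurePreserving S (ν.map φ) (ν.map φ)) (hS' : MeasurePreserving S' (ν.map φ) (ν.map φ))
    (hT : Measurable T) (hT' : MeasurePreserving T' ν ν)
    (hSS' : ∀ x, S (S' x) = x) (hTT' : ∀ y, T (T' y) = y)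
    (heq : ∀ᵐ y ∂ν, φ (T' y) = S' (φ y)) :
    ∀ᵐ x ∂(ν.map φ), (condDistrib id φ ν x).map T = condDistrib id φ ν (S x) := by
  set κ := condDistrib id φ ν with hκ
  have hμ : IsProbabilityMeasure (ν.map φ) := Measure.isProbabilityMeasure_map hφ.aemeasurable
  have hdis : (ν.map φ) ⊗ₘ κ = ν.map (fun y => (φ y, y)) :=
    compProd_map_condDistrib (X := φ) (Y := id) (μ := ν) aemeasurable_id
  have key : κ =ᵐ[ν.map φ] (κ.comap S hS.measurable).map T' := by
    have : IsMarkovKernel ((κ.comap S hS.measurable).map T') :=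
      Kernel.IsMarkovKernel.map _ hT'.measurable
    refine condDistrib_ae_eq_of_measure_eq_compProd φ aemeasurable_id ?_
    refine Measure.ext_prod fun {A B} hA hB => ?_
    have hm : Measurable fun y => (φ y, y) := by fun_prop
    have hm' : Measurable fun y => (φ y, id y) := by fun_prop
    rw [Measure.compProd_apply_prod hA hB, Measure.map_apply hm' (hA.prod hB)]
    simp_rw [Kernel.map_apply' _ hT'.measurable _ hB, Kernel.comap_apply]
    have hmk : Measurable fun x => κ (S x) (T' ⁻¹' B) :=
      (Kernel.measurable_coe κ (hT'.measurable hB)).comp hS.measurable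
    conv_rhs => rw [← hS'.map_eq]
    rw [setLIntegral_map hA hmk hS'.measurable]
    simp_rw [hSS']
    rw [← Measure.compProd_apply_prod (hS'.measurable hA) (hT'.measurable hB), hdis,
      Measure.map_apply hm ((hS'.measurable hA).prod (hT'.measurable hB)),
      ← hT'.measure_preimage (hm' (hA.prod hB)).nullMeasurableSet]
    refine measure_congr ?_
    filter_upwards [heq] with y hy
    have : ((φ (T' y), T' y) ∈ A ×ˢ B) = ((φ y, y) ∈ (S' ⁻¹' A) ×ˢ (T' ⁻¹' B)) := by
      simp [hy]
    exact this
  filter_upwards [key] with x hx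
  rw [hx, Kernel.map_apply _ hT'.measurable, Kernel.comap_apply,
    Measure.map_map hT hT'.measurable]
  have : T ∘ T' = id := funext hTT'
  rw [this, Measure.map_id]

/-- Let `Γ` be a countable group with subgroup `Λ`, let `Γ ↷ (X, μ)` and
`Λ ↷ (Y, ν)` be p.m.p. actions on standard probability spaces, and let `φ : Y → X` be a
`Λ`-equivariant factor map.  Then there exist a p.m.p. action `Γ ↷ (Ȳ, ν̄)` and a
measurable, measure-preserving, `Λ`-equivariant map `π : Ȳ → Y` such that `φ ∘ π` is
`Γ`-equivariant almost everywhere. -/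
theorem stmt12 (Γ : Type u) [Group Γ] [Countable Γ] (Λ : Subgroup Γ)
    (X : Type u) [MeasurableSpace X] [StandardBorelSpace X]
    (Y : Type u) [MeasurableSpace Y] [StandardBorelSpace Y]
    (μ : Measure X) [IsProbabilityMeasure μ]
    (ν : Measure Y) [IsProbabilityMeasure ν]
    (a : PMPAction Γ X μ) (c : PMPAction Λ Y ν)
    (φ : Y → X) (hφmeas : Measurable φ) (hφpush : ν.map φ = μ)
    (hφequiv : ∀ l : Λ, ∀ᵐ y ∂ν, φ (c.act l y) = a.act (l : Γ) (φ y)) :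
    ∃ (Ybar : Type u) (_ : MeasurableSpace Ybar) (nubar : Measure Ybar)
      (_ : IsProbabilityMeasure nubar) (b : PMPAction Γ Ybar nubar) (π : Ybar → Y),
      MeasurePreserving π nubar ν ∧
      (∀ l : Λ, ∀ᵐ ybar ∂nubar, π (b.act (l : Γ) ybar) = c.act l (π ybar)) ∧
      (∀ γ : Γ, ∀ᵐ ybar ∂nubar, φ (π (b.act γ ybar)) = a.act γ (φ (π ybar))) := by
  classical
  subst hφpush
  have hYne : Nonempty Y := nonempty_of_isProbabilityMeasure ν
  set κ := ProbabilityTheory.condDistrib id φ ν with hκ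
  have ham : ∀ γ, Measurable (a.act γ) := fun γ => (a.measurePreserving γ).measurable
  have hcm : ∀ l, Measurable (c.act l) := fun l => (c.measurePreserving l).measurable
  -- equivariance of the disintegration
  have hequiv0 : ∀ l : Λ, ∀ᵐ x ∂(ν.map φ), (κ x).map (c.act l) = κ (a.act (l : Γ) x) := by
    intro l
    refine condDistrib_equivariant ν φ hφmeas (a.act l) (a.act ((l⁻¹ : Λ) : Γ)) (c.act l)
      (c.act l⁻¹) (a.measurePreserving _) (a.measurePreserving _) (hcm l)
      (c.measurePreserving _) ?_ ?_ (hφequiv l⁻¹)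
    · intro x; rw [← a.act_mul]; simp [a.act_one]
    · intro y; rw [← c.act_mul]; simp [c.act_one]
  have hequiv : ∀ (l : Λ) (γ : Γ), ∀ᵐ x ∂(ν.map φ),
      (κ (a.act γ x)).map (c.act l) = κ (a.act ((l : Γ) * γ) x) := by
    intro l γ
    filter_upwards [(a.measurePreserving γ).quasiMeasurePreserving.ae (hequiv0 l)] with x hx
    rw [hx, a.act_mul]
  -- fibers
  have hfib0 : ∀ᵐ x ∂(ν.map φ), ∀ᵐ y ∂(κ x), φ y = x := by
    have hdis : Measure.compProd (ν.map φ) κ = ν.map (fun y => (φ y, y)) :=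
      ProbabilityTheory.compProd_map_condDistrib (X := φ) (Y := id) (μ := ν) aemeasurable_id
    have hset : MeasurableSet {p : X × Y | φ p.2 = p.1} :=
      measurableSet_eq_fun (by fun_prop) (by fun_prop)
    refine Measure.ae_ae_of_ae_compProd (p := fun p : X × Y => φ p.2 = p.1) ?_
    rw [hdis, ae_map_iff (by fun_prop) hset]
    simp
  have hfib : ∀ γ, ∀ᵐ x ∂(ν.map φ), ∀ᵐ y ∂(κ (a.act γ x)), φ y = a.act γ x := fun γ =>
    (a.measurePreserving γ).quasiMeasurePreserving.ae hfib0
  -- cosets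
  let Q := Quotient (QuotientGroup.rightRel Λ)
  let mk : Γ → Q := Quotient.mk _
  let s : Q → Γ := Quotient.out
  have hmk : ∀ x y : Γ, mk x = mk y ↔ y * x⁻¹ ∈ Λ := fun x y =>
    Quotient.eq.trans QuotientGroup.rightRel_apply
  have hs : ∀ q, mk (s q) = q := Quotient.out_eq
  let lam : Γ → Λ := fun γ => ⟨γ * (s (mk γ))⁻¹, (hmk _ _).1 (hs _)⟩
  have hlam : ∀ γ, (lam γ : Γ) * s (mk γ) = γ := fun γ => by simp [lam]
  have hmkl : ∀ (l : Λ) (γ : Γ), mk (l * γ) = mk γ := fun l γ => by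
    rw [hmk]; simp
  have hmkr : ∀ γ g : Γ, mk (s (mk γ) * g) = mk (γ * g) := fun γ g => by
    have := hmkl (lam γ) (s (mk γ) * g)
    rw [← mul_assoc, hlam] at this
    exact this.symm
  have hlaml : ∀ (l : Λ) (γ : Γ), lam (l * γ) = l * lam γ := fun l γ => by
    apply Subtype.ext
    simp only [lam, hmkl, Subgroup.coe_mul, mul_assoc]
  have hlamr : ∀ γ g : Γ, lam (γ * g) = lam γ * lam (s (mk γ) * g) := fun γ g => by
    have := hlaml (lam γ) (s (mk γ) * g)
    rw [← mul_assoc, hlam] at this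
    exact this
  -- the kernel
  let K : ProbabilityTheory.Kernel X (Q → Y) := piKernel (fun q : Q => κ.comap (a.act (s q)) (ham _))
  have hK : ∀ x, K x = Measure.infinitePi (fun q : Q => κ (a.act (s q) x)) := fun x => rfl
  let F : (Q → Y) → (Γ → Y) := fun h γ => c.act (lam γ) (h (mk γ))
  have hF : Measurable F := measurable_pi_lambda _ fun γ =>
    (hcm _).comp (measurable_pi_apply _)
  let P : ProbabilityTheory.Kernel X (Γ → Y) := K.map F
  have : ProbabilityTheory.IsMarkovKernel P := ProbabilityTheory.Kernel.IsMarkovKernel.map _ hF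
  have hP : ∀ x, P x = (K x).map F := fun x => ProbabilityTheory.Kernel.map_apply _ hF _
  have hprob : IsProbabilityMeasure (ν.map φ) :=
    Measure.isProbabilityMeasure_map hφmeas.aemeasurable
  let sh : Γ → (Γ → Y) → (Γ → Y) := fun g f γ => f (γ * g)
  have hsh : ∀ g, Measurable (sh g) := fun g => measurable_pi_lambda _ fun γ =>
    measurable_pi_apply _
  -- invariance
  have hshift : ∀ g, ∀ᵐ x ∂(ν.map φ), (P x).map (sh g) = P (a.act g x) := by
    intro g
    have h1 : ∀ᵐ x ∂(ν.map φ), ∀ q : Q,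
        (κ (a.act (s (mk (s q * g))) x)).map (c.act (lam (s q * g))) = κ (a.act (s q * g) x) := by
      rw [ae_all_iff]
      intro q
      filter_upwards [hequiv (lam (s q * g)) (s (mk (s q * g)))] with x hx
      rw [hx, hlam]
    filter_upwards [h1] with x hx
    have hinj : Function.Injective (fun q : Q => mk (s q * g)) := by
      intro q q' h
      have h' := (hmk _ _).1 h
      rw [← hs q, ← hs q', hmk]
      simpa [mul_assoc] using h'
    have hR := map_infinitePi_reindex (fun q : Q => κ (a.act (s q) x))
      (fun q : Q => mk (s q * g)) hinj (fun q => c.act (lam (s q * g))) (fun q => hcm _)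
    have hR' : Measurable (fun (h : Q → Y) (q : Q) => c.act (lam (s q * g)) (h (mk (s q * g)))) :=
      measurable_pi_lambda _ fun q => (hcm _).comp (measurable_pi_apply _)
    have hcomp : sh g ∘ F =
        F ∘ (fun (h : Q → Y) (q : Q) => c.act (lam (s q * g)) (h (mk (s q * g)))) := by
      funext h γ
      simp only [Function.comp, sh, F]
      rw [← c.act_mul, ← hlamr, hmkr]
    rw [hP, hP, Measure.map_map (hsh g) hF, hcomp, ← Measure.map_map hF hR', hK, hK, hR]
    congr 2
    funext q
    rw [hx, a.act_mul]
  -- marginals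
  have hmarg : ∀ γ : Γ, ∀ᵐ x ∂(ν.map φ), (P x).map (fun f => f γ) = κ (a.act γ x) := by
    intro γ
    filter_upwards [hequiv (lam γ) (s (mk γ))] with x hx
    rw [hlam] at hx
    rw [hP, Measure.map_map (measurable_pi_apply _) hF, ← hx, hK,
      ← Measure.infinitePi_map_eval (fun q : Q => κ (a.act (s q) x)) (mk γ),
      Measure.map_map (hcm _) (measurable_pi_apply _)]
    rfl
  have hinv : ∀ g, ((ν.map φ).bind P).map (sh g) = (ν.map φ).bind P := by
    intro g
    rw [Measure.map_comp _ _ (hsh g)]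
    have h2 : (ν.map φ).bind (P.map (sh g)) =
        (ν.map φ).bind (P.comap (a.act g) (ham g)) := by
      refine Measure.comp_congr ?_
      filter_upwards [hshift g] with x hx
      rw [ProbabilityTheory.Kernel.map_apply _ (hsh g), hx, ProbabilityTheory.Kernel.comap_apply]
    rw [h2]
    ext A hA
    rw [Measure.bind_apply hA (ProbabilityTheory.Kernel.aemeasurable _),
      Measure.bind_apply hA (ProbabilityTheory.Kernel.aemeasurable _)]
    conv_rhs => rw [← (a.measurePreserving g).map_eq]
    rw [lintegral_map (P.measurable_coe hA) (ham g)]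
    rfl
  let b : PMPAction Γ (Γ → Y) ((ν.map φ).bind P) :=
    { act := sh
      measurePreserving := fun g => ⟨hsh g, hinv g⟩
      act_one := fun f => by funext γ; simp [sh]
      act_mul := fun g h f => by funext γ; simp [sh, mul_assoc] }
  refine ⟨Γ → Y, inferInstance, (ν.map φ).bind P, inferInstance, b, fun f => f 1, ?_, ?_, ?_⟩
  · refine ⟨measurable_pi_apply _, ?_⟩
    rw [Measure.map_comp _ _ (measurable_pi_apply _)]
    have h2 : (ν.map φ).bind (P.map (fun f => f 1)) = (ν.map φ).bind κ := by
      refine Measure.comp_congr ?_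
      filter_upwards [hmarg 1] with x hx
      rw [ProbabilityTheory.Kernel.map_apply _ (measurable_pi_apply _), hx, a.act_one]
    rw [h2, hκ, ProbabilityTheory.condDistrib_comp_map hφmeas.aemeasurable aemeasurable_id,
      Measure.map_id]
  · intro l
    have hset : MeasurableSet {f : Γ → Y | f (1 * (l : Γ)) = c.act l (f 1)} :=
      measurableSet_eq_fun (measurable_pi_apply _) ((hcm l).comp (measurable_pi_apply _))
    refine Measure.ae_comp_of_ae_ae hset (Filter.Eventually.of_forall fun x => ?_)
    rw [hP, ae_map_iff hF.aemeasurable hset]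
    refine Filter.Eventually.of_forall fun h => ?_
    have e1 := hlaml l 1
    have e2 := hmkl l 1
    simp only [F]
    rw [← c.act_mul, one_mul, ← e1, ← e2, mul_one]
  · intro γ
    have hset : MeasurableSet {f : Γ → Y | φ (f (1 * γ)) = a.act γ (φ (f 1))} :=
      measurableSet_eq_fun (hφmeas.comp (measurable_pi_apply _))
        ((ham γ).comp (hφmeas.comp (measurable_pi_apply _)))
    refine Measure.ae_comp_of_ae_ae hset ?_
    filter_upwards [hmarg γ, hmarg 1, hfib γ, hfib 1] with x h1 h2 h3 h4
    rw [← h1] at h3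
    rw [← h2] at h4
    filter_upwards [ae_of_ae_map (measurable_pi_apply _).aemeasurable h3,
      ae_of_ae_map (measurable_pi_apply _).aemeasurable h4] with f h5 h6
    change φ (f (1 * γ)) = a.act γ (φ (f 1))
    rw [one_mul, h5, h6, a.act_one]

end Stmt12
end

section
/- Let Γ be a countable group and Λ ◁ Γ a normal subgroup such that the quotient group Γ/Λ is amenable. Suppose Γ ↷ᵃ (X, μ) is a p.m.p. action that weakly contains some p.m.p. action Γ ↷ᵇ (Y, ν) on a standard Borel probability space in which the stabilizer of every point y ∈ Y equals Λ. Then for every finite set S ⊆ Γ with e ∈ S and every ε > 0, there is a measurable map c : X → Γ/Λ with finite image such that μ({x ∈ X : c(s⁻¹·x) = c(x)·s for all s ∈ S}) > 1 − ε, where c(x)·s denotes the right translate of the coset c(x) by s. -/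
open MeasureTheory

namespace Stmt14

/-- A probability-measure-preserving action of a group `Γ` on `(X, μ)`. -/
structure PMPAction (Γ : Type*) [Group Γ] (X : Type*) [MeasurableSpace X]
    (μ : Measure X) where
  act : Γ → X → X
  measurePreserving : ∀ γ, MeasurePreserving (act γ) μ μ
  act_one : ∀ x, act 1 x = x
  act_mul : ∀ γ₁ γ₂ x, act (γ₁ * γ₂) x = act γ₁ (act γ₂ x)

/-- `Γ ↷ᵃ (X, μ)` weakly contains `Γ ↷ᵇ (Y, ν)`: finitely many measurable sets of `Y`
can be simulated, up to `ε` and finitely many group elements, by measurable sets of `X`.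
(Here `γ · B` is formalized as the preimage of `B` under the action of `γ⁻¹`.) -/
def WeaklyContains {Γ : Type*} [Group Γ] {X Y : Type*} [MeasurableSpace X]
    [MeasurableSpace Y] {μ : Measure X} {ν : Measure Y}
    (a : PMPAction Γ X μ) (b : PMPAction Γ Y ν) : Prop :=
  ∀ (n : ℕ) (B : Fin n → Set Y), (∀ i, MeasurableSet (B i)) →
    ∀ (F : Finset Γ) (ε : ℝ), 0 < ε →
    ∃ A : Fin n → Set X, (∀ i, MeasurableSet (A i)) ∧
      ∀ γ ∈ F, ∀ i j : Fin n,
        |(ν (b.act γ⁻¹ ⁻¹' B i ∩ B j)).toReal -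
          (μ (a.act γ⁻¹ ⁻¹' A i ∩ A j)).toReal| < ε

/-- A group is amenable if it admits a left-invariant finitely additive probability
measure defined on all of its subsets. -/
def IsAmenable (G : Type*) [Group G] : Prop :=
  ∃ m : Set G → ℝ, m Set.univ = 1 ∧ (∀ A, 0 ≤ m A) ∧
    (∀ A B : Set G, Disjoint A B → m (A ∪ B) = m A + m B) ∧
    (∀ (g : G) (A : Set G), m ((fun x => g * x) '' A) = m A)

open scoped Pointwise in
theorem folner_aux {G : Type*} [Group G] [DecidableEq G] (h : IsAmenable G) (K : Finset G)
    (hK : ∀ F : Finset G, 2 * F.card ≤ (F * K).card) : False := by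
  classical
  obtain ⟨m, m1, m0, madd, minv⟩ := h
  have hall : ∃ f : G × Bool → G, Function.Injective f ∧ ∀ x, f x ∈ ({x.1} * K : Finset G) := by
    rw [← Finset.all_card_le_biUnion_card_iff_exists_injective (fun x : G × Bool => ({x.1} * K : Finset G))]
    intro W
    have h1 : W ⊆ (W.image Prod.fst) ×ˢ Finset.univ := by
      intro x hx
      simp only [Finset.mem_product, Finset.mem_univ, and_true, Finset.mem_image]
      exact ⟨x, hx, rfl⟩
    have h2 := Finset.card_le_card h1
    rw [Finset.card_product] at h2
    have h3 := hK (W.image Prod.fst)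
    have h4 : (W.image Prod.fst) * K ⊆ W.biUnion (fun x : G × Bool => ({x.1} * K : Finset G)) := by
      intro y hy
      obtain ⟨a, ha, k, hk, rfl⟩ := Finset.mem_mul.1 hy
      obtain ⟨x, hx, rfl⟩ := Finset.mem_image.1 ha
      exact Finset.mem_biUnion.2 ⟨x, hx, Finset.mul_mem_mul (Finset.mem_singleton_self _) hk⟩
    have h5 := Finset.card_le_card h4
    simp at h2
    omega
  obtain ⟨f, finj, hf⟩ := hall
  have mempty : m ∅ = 0 := by
    have := madd ∅ ∅ (by simp)
    simp at this
    exact this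
  have msum : ∀ {ι : Type _} (s : Finset ι) (B : ι → Set G),
      (∀ i ∈ s, ∀ j ∈ s, i ≠ j → Disjoint (B i) (B j)) →
      m (⋃ i ∈ s, B i) = ∑ i ∈ s, m (B i) := by
    intro ι s B
    induction s using Finset.induction_on with
    | empty => intro _; simpa using mempty
    | insert a s ha ih =>
      intro hd
      rw [Finset.set_biUnion_insert, Finset.sum_insert ha, madd, ih]
      · intro i hi j hj
        exact hd i (Finset.mem_insert_of_mem hi) j (Finset.mem_insert_of_mem hj)
      · simp only [Set.disjoint_iUnion_right]
        intro i hi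
        refine hd a (Finset.mem_insert_self _ _) i (Finset.mem_insert_of_mem hi) ?_
        rintro rfl; exact ha hi
  have mle : ∀ A : Set G, m A ≤ 1 := by
    intro A
    have := madd A Aᶜ disjoint_compl_right
    rw [Set.union_compl_self, m1] at this
    linarith [m0 Aᶜ]
  -- pieces
  let A : Bool × G → Set G := fun p => {g | f (g⁻¹, p.1) = g⁻¹ * p.2}
  let C : Bool × G → Set G := fun p => (fun x => p.2⁻¹ * x) '' (A p)
  have hC : ∀ p, m (C p) = m (A p) := fun p => minv _ _
  have hAsum : ∀ i, ∑ k ∈ K, m (A (i, k)) = 1 := by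
    intro i
    rw [← msum K (fun k => A (i, k)), ← m1]
    · congr 1
      ext g
      simp only [Set.mem_iUnion, Set.mem_univ, iff_true]
      have := hf (g⁻¹, i)
      obtain ⟨a, ha, k, hk, hak⟩ := Finset.mem_mul.1 this
      rw [Finset.mem_singleton] at ha
      subst ha
      exact ⟨k, hk, hak.symm⟩
    · intro k _ l _ hkl
      rw [Set.disjoint_left]
      intro g h1 h2
      apply hkl
      have h1' : f (g⁻¹, i) = g⁻¹ * k := h1
      have h2' : f (g⁻¹, i) = g⁻¹ * l := h2
      exact mul_left_cancel (h1'.symm.trans h2')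
  have hCd := msum (Finset.univ ×ˢ K) C (by
    rintro ⟨i, k⟩ _ ⟨j, l⟩ _ hne
    rw [Set.disjoint_left]
    rintro x ⟨g, hg, rfl⟩ ⟨g', hg', hx⟩
    apply hne
    have h1 : f (g⁻¹, i) = g⁻¹ * k := hg
    have h2 : f (g'⁻¹, j) = g'⁻¹ * l := hg'
    have hx' : l⁻¹ * g' = k⁻¹ * g := hx
    have h3 : g⁻¹ * k = g'⁻¹ * l := by
      have := congrArg (·⁻¹) hx'
      simpa using this.symm
    have h4 := finj (h1.trans (h3.trans h2.symm))
    rw [Prod.mk.injEq, inv_inj] at h4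
    obtain ⟨rfl, rfl⟩ := h4
    rw [mul_left_cancel h3])
  rw [Finset.sum_congr rfl (fun p _ => hC p), Finset.sum_product] at hCd
  simp only [hAsum] at hCd
  have := mle (⋃ i ∈ Finset.univ ×ˢ K, C i)
  rw [hCd] at this
  simp at this

open scoped Pointwise in
theorem folner {G : Type*} [Group G] [DecidableEq G] (h : IsAmenable G) (S : Finset G)
    (δ : ℝ) (hδ : 0 < δ) :
    ∃ F : Finset G, F.Nonempty ∧ ∀ s ∈ S,
      ((F.filter (fun g => g * s ∉ F)).card : ℝ) ≤ δ * F.card := by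
  by_contra hcon
  push Not at hcon
  let K := insert 1 S
  have hstep : ∀ F : Finset G, (1 + δ) * F.card ≤ (F * K).card := by
    intro F
    rcases F.eq_empty_or_nonempty with rfl | hF
    · simp
    obtain ⟨s, hs, hlt⟩ := hcon F hF
    have hsub : F ∪ (F.filter (fun g => g * s ∉ F)).image (· * s) ⊆ F * K := by
      intro x hx
      rcases Finset.mem_union.1 hx with hx | hx
      · exact Finset.mem_mul.2 ⟨x, hx, 1, Finset.mem_insert_self _ _, mul_one x⟩
      · obtain ⟨g, hg, rfl⟩ := Finset.mem_image.1 hx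
        exact Finset.mul_mem_mul (Finset.mem_filter.1 hg).1 (Finset.mem_insert_of_mem hs)
    have h1 := Finset.card_le_card hsub
    rw [Finset.card_union_of_disjoint, Finset.card_image_of_injective _ (mul_left_injective s)] at h1
    · have : ((F.card + (F.filter (fun g => g * s ∉ F)).card : ℕ) : ℝ) ≤ (F * K).card := by
        exact_mod_cast h1
      push_cast at this
      linarith
    · rw [Finset.disjoint_right]
      intro x hx
      obtain ⟨g, hg, rfl⟩ := Finset.mem_image.1 hx
      exact (Finset.mem_filter.1 hg).2
  have hpow : ∀ n : ℕ, ∀ F : Finset G, (1 + δ) ^ n * F.card ≤ (F * K ^ n).card := by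
    intro n
    induction n with
    | zero => intro F; simp
    | succ n ih =>
      intro F
      have h1 := hstep (F * K ^ n)
      rw [mul_assoc, ← pow_succ] at h1
      have h2 := mul_le_mul_of_nonneg_left (ih F) (by linarith : 0 ≤ 1 + δ)
      rw [pow_succ]
      linarith
  obtain ⟨n, hn⟩ := pow_unbounded_of_one_lt 2 (by linarith : 1 < 1 + δ)
  refine folner_aux h (K ^ n) (fun F => ?_)
  have h1 := hpow n F
  have h2 : (2 : ℝ) * F.card ≤ (F * K ^ n).card :=
    le_trans (mul_le_mul_of_nonneg_right hn.le (by positivity)) h1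
  exact_mod_cast h2

theorem coloring {G : Type*} [Group G] {Y : Type*} [MeasurableSpace Y]
    [StandardBorelSpace Y] (ν : Measure Y) [IsProbabilityMeasure ν] [MulAction G Y]
    (hmp : ∀ g : G, MeasurePreserving (fun y : Y => g • y) ν ν)
    (hfree : ∀ (g : G) (y : Y), g • y = y → g = 1) (F : Finset G) (δ : ℝ) (hδ : 0 < δ) :
    ∃ (n : ℕ) (P : (Fin n → Bool) → Set Y), (∀ w, MeasurableSet (P w)) ∧
      (∀ w, ∀ g ∈ F, ∀ h ∈ F, ∀ y, g • y ∈ P w → h • y ∈ P w → g = h) ∧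
      1 - δ < ν.real (⋃ w, P w) := by
  obtain ⟨f, fm, finj⟩ := MeasurableSpace.measurable_injection_nat_bool_of_countablySeparated Y
  have fim : ∀ i, Measurable fun y => f y i := fun i => (measurable_pi_apply i).comp fm
  let E : ℕ → Set Y := fun n =>
    ⋂ g ∈ F, ⋂ h ∈ F, {y | g ≠ h → ∃ i < n, f ((h * g⁻¹) • y) i ≠ f y i}
  have Em : ∀ n, MeasurableSet (E n) := by
    intro n
    refine Finset.measurableSet_biInter _ fun g _ => Finset.measurableSet_biInter _ fun h _ => ?_
    by_cases hgh : g = h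
    · simp [hgh]
    have : {y | g ≠ h → ∃ i < n, f ((h * g⁻¹) • y) i ≠ f y i} =
        ⋃ i, ⋃ (_ : i < n), {y | f ((h * g⁻¹) • y) i = f y i}ᶜ := by
      ext y; simp [hgh]
    rw [this]
    refine MeasurableSet.iUnion fun i => MeasurableSet.iUnion fun _ => MeasurableSet.compl ?_
    exact measurableSet_eq_fun ((fim i).comp (hmp _).measurable) (fim i)
  have Emono : Monotone E := by
    intro n n' hn y hy
    simp only [E, Set.mem_iInter, Set.mem_ofPred_eq] at hy ⊢
    intro g hg h hh hne
    obtain ⟨i, hi, h2⟩ := hy g hg h hh hne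
    exact ⟨i, by omega, h2⟩
  have Eun : ⋃ n, E n = Set.univ := by
    rw [Set.eq_univ_iff_forall]
    intro y
    have : ∀ p : G × G, ∃ i, p.1 ≠ p.2 → f ((p.2 * p.1⁻¹) • y) i ≠ f y i := by
      rintro ⟨g, h⟩
      by_cases hgh : g = h
      · exact ⟨0, fun h => absurd hgh h⟩
      · have h1 : (h * g⁻¹) • y ≠ y := by
          intro h2
          have := hfree _ _ h2
          exact hgh (mul_inv_eq_one.1 this).symm
        have h2 : f ((h * g⁻¹) • y) ≠ f y := fun h3 => h1 (finj h3)
        obtain ⟨i, hi⟩ := Function.ne_iff.1 h2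
        exact ⟨i, fun _ => hi⟩
    choose i hi using this
    refine Set.mem_iUnion.2 ⟨(F ×ˢ F).sup i + 1, ?_⟩
    simp only [E, Set.mem_iInter, Set.mem_ofPred_eq]
    intro g hg h hh hne
    refine ⟨i (g, h), ?_, hi (g, h) hne⟩
    have := Finset.le_sup (f := i) (Finset.mk_mem_product hg hh)
    omega
  have htend := tendsto_measure_iUnion_atTop (μ := ν) Emono
  rw [Eun, measure_univ] at htend
  have htend' := (ENNReal.tendsto_toReal ENNReal.one_ne_top).comp htend
  have hev := htend'.eventually (lt_mem_nhds (show 1 - δ < (1 : ENNReal).toReal by simp; linarith))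
  obtain ⟨n, hn⟩ := hev.exists
  refine ⟨n, fun w => E n ∩ {y | ∀ i : Fin n, f y i = w i}, ?_, ?_, ?_⟩
  · intro w
    refine (Em n).inter ?_
    rw [Set.ofPred_forall]
    exact MeasurableSet.iInter fun i => measurableSet_eq_fun (fim i) measurable_const
  · rintro w g hg h hh y ⟨h1, h2⟩ ⟨h3, h4⟩
    by_contra hne
    simp only [E, Set.mem_iInter, Set.mem_ofPred_eq] at h1 h2 h4
    obtain ⟨i, hi, h5⟩ := h1 g hg h hh hne
    rw [smul_smul, inv_mul_cancel_right] at h5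
    exact h5 ((h4 ⟨i, hi⟩).trans (h2 ⟨i, hi⟩).symm)
  · have : (⋃ w : Fin n → Bool, E n ∩ {y | ∀ i : Fin n, f y i = w i}) = E n := by
      ext y
      simp only [Set.mem_iUnion, Set.mem_inter_iff, Set.mem_ofPred_eq]
      exact ⟨fun ⟨w, h, _⟩ => h, fun h => ⟨fun i => f y i, h, fun _ => rfl⟩⟩
    rw [this]
    exact hn

/-- bad edges touching the domain of the partial map `c` -/
def badE {G Y : Type*} [Group G] [MulAction G Y] (c : Y → Option G) (s : G) : Set Y :=
  {y | (c y ≠ none ∨ c (s⁻¹ • y) ≠ none) ∧ ¬ ∃ q, c y = some q ∧ c (s⁻¹ • y) = some (q * s)}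

theorem extend {G : Type*} [Group G] [DecidableEq G] {Y : Type*} [MeasurableSpace Y]
    (ν : Measure Y) [IsProbabilityMeasure ν] [MulAction G Y]
    (hmp : ∀ g : G, MeasurePreserving (fun y : Y => g • y) ν ν)
    (S F : Finset G) (hFne : F.Nonempty) (ε : ℝ) (hε : 0 < ε)
    (hF : ∑ g ∈ F, (((S.filter (fun s => g * s ∉ F)).card : ℝ) +
      ((S.filter (fun s => g * s⁻¹ ∉ F)).card : ℝ)) ≤ ε / 2 * F.card)
    (n : ℕ) (P : (Fin n → Bool) → Set Y) (Pm : ∀ w, MeasurableSet (P w))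
    (hP : ∀ w, ∀ g ∈ F, ∀ h ∈ F, ∀ y, g • y ∈ P w → h • y ∈ P w → g = h)
    (δ : ℝ) (hδ : 0 < δ) (hPν : 1 - δ / 4 < ν.real (⋃ w, P w))
    (c : Y → Option G) (cm : ∀ q, MeasurableSet (c ⁻¹' {q})) (cf : (Set.range c).Finite)
    (hc : ∑ s ∈ S, ν.real (badE c s) ≤ ε * ν.real {y | c y ≠ none})
    (hA : δ ≤ ν.real {y | c y = none}) :
    ∃ c' : Y → Option G, (∀ q, MeasurableSet (c' ⁻¹' {q})) ∧ (Set.range c').Finite ∧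
      ∑ s ∈ S, ν.real (badE c' s) ≤ ε * ν.real {y | c' y ≠ none} ∧
      ν.real {y | c y ≠ none} + δ / 4 / 2 ^ n ≤ ν.real {y | c' y ≠ none} := by
  classical
  set A : Set Y := {y | c y = none} with hAdef
  have Am : MeasurableSet A := cm none
  let w : G → ℝ := fun g => ((S.filter (fun s => g * s ∉ F)).card : ℝ) +
      ((S.filter (fun s => g * s⁻¹ ∉ F)).card : ℝ)
  have w0 : ∀ g, 0 ≤ w g := fun g => by positivity
  let Ag : G → Set Y := fun g => (fun y => g⁻¹ • y) ⁻¹' A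
  have Agm : ∀ g, MeasurableSet (Ag g) := fun g => (hmp g⁻¹).measurable Am
  let h : Y → ℝ := fun y => ∑ g ∈ F, (ε - w g) * (Ag g).indicator 1 y
  have hi : ∀ g, Integrable ((Ag g).indicator (1 : Y → ℝ)) ν := fun g =>
    (integrable_const (1 : ℝ)).indicator (Agm g)
  have hhm : Measurable h := by
    refine Finset.measurable_sum _ fun g _ => ?_
    exact (measurable_one.indicator (Agm g)).const_mul _
  have hhi : Integrable h ν := integrable_finsetSum _ fun g _ => (hi g).const_mul _
  have h_integral : ∀ D, MeasurableSet D →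
      ∫ y in D, h y ∂ν = ∑ g ∈ F, (ε - w g) * ν.real (Ag g ∩ D) := by
    intro D hD
    rw [integral_finsetSum _ fun g _ => ((hi g).const_mul _).integrableOn]
    refine Finset.sum_congr rfl fun g _ => ?_
    rw [integral_const_mul, integral_indicator_one (Agm g), measureReal_restrict_apply (Agm g)]
  let Q : Set Y := {y | 0 < h y}
  have Qm : MeasurableSet Q := measurableSet_lt measurable_const hhm
  have hQ : ν.real A / 2 ≤ ν.real Q := by
    have h1 : ∫ y, h y ∂ν = ∑ g ∈ F, (ε - w g) * ν.real A := by
      have := h_integral Set.univ MeasurableSet.univ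
      rw [Measure.restrict_univ] at this
      rw [this]
      refine Finset.sum_congr rfl fun g _ => ?_
      rw [Set.inter_univ, (hmp g⁻¹).measureReal_preimage Am.nullMeasurableSet]
    have h2 : ∫ y, h y ∂ν ≤ ∫ y, Q.indicator (fun _ => ε * F.card) y ∂ν := by
      refine integral_mono hhi ((integrable_const _).indicator Qm) fun y => ?_
      by_cases hy : y ∈ Q
      · rw [Set.indicator_of_mem hy]
        calc h y ≤ ∑ g ∈ F, ε := by
              refine Finset.sum_le_sum fun g _ => ?_
              by_cases hg : y ∈ Ag g
              · rw [Set.indicator_of_mem hg]; simp; exact w0 g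
              · rw [Set.indicator_of_notMem hg]; simp; exact hε.le
          _ = ε * F.card := by rw [Finset.sum_const, nsmul_eq_mul, mul_comm]
      · rw [Set.indicator_of_notMem hy]; exact not_lt.1 hy
    rw [integral_indicator_const _ Qm, h1, ← Finset.sum_mul, Finset.sum_sub_distrib,
      Finset.sum_const, nsmul_eq_mul, smul_eq_mul] at h2
    have hFc : (0 : ℝ) < F.card := by exact_mod_cast hFne.card_pos
    have h3 : ε / 2 * F.card * ν.real A ≤ (F.card * ε - ∑ g ∈ F, w g) * ν.real A :=
      mul_le_mul_of_nonneg_right (by linarith) measureReal_nonneg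
    have h4 : (ε * F.card) * (ν.real A / 2) ≤ (ε * F.card) * ν.real Q := by linarith
    exact le_of_mul_le_mul_left h4 (by positivity)
  -- choose a colour
  obtain ⟨k, hk⟩ : ∃ k, δ / 4 / 2 ^ n ≤ ν.real (Q ∩ P k) := by
    by_contra hcon
    push Not at hcon
    have h1 : ν.real (Q ∩ ⋃ k, P k) ≤ ∑ k, ν.real (Q ∩ P k) := by
      rw [Set.inter_iUnion]; exact measureReal_iUnion_fintype_le _
    have h2 : ∑ k, ν.real (Q ∩ P k) ≤ ∑ k : Fin n → Bool, δ / 4 / 2 ^ n :=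
      Finset.sum_le_sum fun k _ => (hcon k).le
    have h3 : ∑ k : Fin n → Bool, δ / 4 / 2 ^ n = δ / 4 := by
      simp; field_simp
    have Um : MeasurableSet (⋃ k, P k) := MeasurableSet.iUnion Pm
    have h4 := measureReal_inter_add_sdiff (μ := ν) (s := Q) Um
    have h5 : ν.real (Q \ ⋃ k, P k) ≤ ν.real (⋃ k, P k)ᶜ :=
      measureReal_mono (fun y hy => hy.2)
    rw [probReal_compl_eq_one_sub Um] at h5
    linarith
  set D : Set Y := Q ∩ P k with hD
  have Dm : MeasurableSet D := Qm.inter (Pm k)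
  have hDu : ∀ g ∈ F, ∀ h ∈ F, ∀ y, g • y ∈ D → h • y ∈ D → g = h :=
    fun g hg h hh y h1 h2 => hP k g hg h hh y h1.2 h2.2
  let V : G → Set Y := fun g => A ∩ (fun y => g • y) ⁻¹' D
  have Vm : ∀ g, MeasurableSet (V g) := fun g => Am.inter ((hmp g).measurable Dm)
  have hV : ∀ g, ν.real (V g) = ν.real (Ag g ∩ D) := by
    intro g
    rw [← (hmp g).measureReal_preimage ((Agm g).inter Dm).nullMeasurableSet]
    congr 1
    ext y
    simp [V, Ag]
  have hVd : (F : Set G).PairwiseDisjoint V := by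
    intro g hg h hh hne
    rw [Function.onFun, Set.disjoint_left]
    intro y h1 h2
    exact hne (hDu g hg h hh y h1.2 h2.2)
  have hVun : ν.real (⋃ g ∈ F, V g) = ∑ g ∈ F, ν.real (V g) :=
    measureReal_biUnion_finset hVd fun g _ => Vm g
  have hVD : ν.real D ≤ ν.real (⋃ g ∈ F, V g) := by
    rw [hVun, Finset.sum_congr rfl fun g _ => hV g]
    refine le_trans (measureReal_mono ?_ (measure_ne_top _ _)) (measureReal_biUnion_finset_le F fun g => Ag g ∩ D)
    intro y hy
    by_contra hcon
    simp only [Set.mem_iUnion, not_exists] at hcon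
    have h0 : 0 < h y := hy.1
    have : h y = 0 := by
      refine Finset.sum_eq_zero fun g hg => ?_
      rw [Set.indicator_of_notMem (fun h1 => hcon g hg ⟨h1, hy⟩), mul_zero]
    linarith
  have hVw : ∑ g ∈ F, w g * ν.real (V g) ≤ ε * ν.real (⋃ g ∈ F, V g) := by
    have h1 : 0 ≤ ∫ y in D, h y ∂ν :=
      setIntegral_nonneg Dm fun y hy => le_of_lt hy.1
    rw [h_integral D Dm] at h1
    rw [hVun, Finset.mul_sum]
    simp only [← hV, sub_mul, Finset.sum_sub_distrib] at h1
    linarith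
  -- new map
  let c' : Y → Option G := fun y => if c y ≠ none then c y else
    if hy : ∃ g ∈ F, g • y ∈ D then some hy.choose else none
  have c'old : ∀ y, c y ≠ none → c' y = c y := fun y hy => if_pos hy
  have c'new : ∀ y, c y = none → ∀ g, (c' y = some g ↔ g ∈ F ∧ g • y ∈ D) := by
    intro y hy g
    simp only [c', hy, ne_eq, not_true_eq_false, if_false]
    split_ifs with h1
    · have h2 := h1.choose_spec
      rw [Option.some_inj]
      constructor
      · rintro rfl; exact h2
      · rintro ⟨h3, h4⟩; exact hDu _ h2.1 _ h3 y h2.2 h4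
    · simp only [false_iff]
      exact fun h2 => h1 ⟨g, h2⟩
  have c'some : ∀ g, c' ⁻¹' {some g} = c ⁻¹' {some g} ∪ (if g ∈ F then V g else ∅) := by
    intro g
    ext y
    simp only [Set.mem_preimage, Set.mem_singleton_iff, Set.mem_union]
    by_cases hy : c y = none
    · rw [c'new y hy]
      by_cases hg : g ∈ F <;> simp [hg, hy, V, A]
    · rw [c'old y hy]
      by_cases hg : g ∈ F <;> simp [hg, hy, V, A]
  have c'dom : {y | c' y ≠ none} = {y | c y ≠ none} ∪ ⋃ g ∈ F, V g := by
    ext y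
    simp only [Set.mem_ofPred_eq, Set.mem_union, Set.mem_iUnion]
    by_cases hy : c y = none
    · rw [Option.ne_none_iff_exists']
      simp only [c'new y hy]
      simp [hy, V, A]
    · rw [c'old y hy]; simp [hy]
  have domm : MeasurableSet {y | c y ≠ none} := Am.compl
  have hVunm : MeasurableSet (⋃ g ∈ F, V g) := Finset.measurableSet_biUnion _ fun g _ => Vm g
  have hdomν : ν.real {y | c' y ≠ none} = ν.real {y | c y ≠ none} + ν.real (⋃ g ∈ F, V g) := by
    rw [c'dom, measureReal_union ?_ hVunm (measure_ne_top _ _) (measure_ne_top _ _)]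
    rw [Set.disjoint_left]
    intro y h1 h2
    simp only [Set.mem_iUnion] at h2
    obtain ⟨g, _, h2⟩ := h2
    exact h1 h2.1
  refine ⟨c', ?_, ?_, ?_, ?_⟩
  · rintro (_ | g)
    · have : c' ⁻¹' {none} = {y | c' y ≠ none}ᶜ := by ext y; simp
      rw [this, c'dom]
      exact (domm.union hVunm).compl
    · rw [c'some]
      refine (cm _).union ?_
      split_ifs
      · exact Vm g
      · exact MeasurableSet.empty
  · refine (cf.union ((F.finite_toSet.image some).union (Set.finite_singleton none))).subset ?_
    rintro _ ⟨y, rfl⟩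
    by_cases hy : c y = none
    · right
      rcases hq : c' y with _ | g
      · right; rfl
      · left; exact ⟨g, ((c'new y hy g).1 hq).1, rfl⟩
    · left; exact ⟨y, (c'old y hy).symm⟩
  · have key : ∀ s ∈ S, ν.real (badE c' s) ≤ ν.real (badE c s) +
        (∑ g ∈ F, (if g * s ∉ F then ν.real (V g) else 0) +
          ∑ g ∈ F, (if g * s⁻¹ ∉ F then ν.real (V g) else 0)) := by
      intro s _
      have hsub : badE c' s ⊆ badE c s ∪ ((⋃ g ∈ F.filter (fun g => g * s ∉ F), V g) ∪
          (⋃ g ∈ F.filter (fun g => g * s⁻¹ ∉ F), (fun y => s⁻¹ • y) ⁻¹' V g)) := by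
        rintro y ⟨h1, h2⟩
        by_cases ht : c y ≠ none ∨ c (s⁻¹ • y) ≠ none
        · left
          refine ⟨ht, ?_⟩
          rintro ⟨q, h3, h4⟩
          apply h2
          refine ⟨q, ?_, ?_⟩
          · rw [c'old y (by simp [h3]), h3]
          · rw [c'old _ (by simp [h4]), h4]
        · right
          push Not at ht
          obtain ⟨t1, t2⟩ := ht
          rcases h1 with h1 | h1
          · left
            obtain ⟨g, hg⟩ := Option.ne_none_iff_exists'.1 h1
            have hg' := (c'new y t1 g).1 hg
            simp only [Set.mem_iUnion, Finset.mem_filter]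
            refine ⟨g, ⟨hg'.1, fun hgs => h2 ⟨g, hg, ?_⟩⟩, t1, hg'.2⟩
            rw [c'new _ t2]
            refine ⟨hgs, ?_⟩
            rw [smul_smul, mul_inv_cancel_right]; exact hg'.2
          · right
            obtain ⟨g, hg⟩ := Option.ne_none_iff_exists'.1 h1
            have hg' := (c'new _ t2 g).1 hg
            simp only [Set.mem_iUnion, Finset.mem_filter]
            refine ⟨g, ⟨hg'.1, fun hgs => h2 ⟨g * s⁻¹, ?_, ?_⟩⟩, t2, hg'.2⟩
            · rw [c'new _ t1]
              refine ⟨hgs, ?_⟩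
              rw [mul_smul]; exact hg'.2
            · rw [hg, inv_mul_cancel_right]
      refine (measureReal_mono hsub).trans ((measureReal_union_le _ _).trans ?_)
      refine add_le_add le_rfl ((measureReal_union_le _ _).trans (add_le_add ?_ ?_))
      · refine (measureReal_biUnion_finset_le _ _).trans (le_of_eq ?_)
        rw [Finset.sum_filter]
      · refine (measureReal_biUnion_finset_le _ _).trans (le_of_eq ?_)
        rw [← Finset.sum_filter]
        exact Finset.sum_congr rfl fun g _ =>
          (hmp s⁻¹).measureReal_preimage (Vm g).nullMeasurableSet
    have h1 := Finset.sum_le_sum key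
    have h2 : ∑ s ∈ S, (∑ g ∈ F, (if g * s ∉ F then ν.real (V g) else 0) +
          ∑ g ∈ F, (if g * s⁻¹ ∉ F then ν.real (V g) else 0)) = ∑ g ∈ F, w g * ν.real (V g) := by
      rw [Finset.sum_add_distrib, Finset.sum_comm, Finset.sum_comm (s := S),
        ← Finset.sum_add_distrib]
      refine Finset.sum_congr rfl fun g _ => ?_
      rw [← Finset.sum_filter, ← Finset.sum_filter, Finset.sum_const, Finset.sum_const,
        nsmul_eq_mul, nsmul_eq_mul, add_mul]
    rw [Finset.sum_add_distrib, h2] at h1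
    rw [hdomν, mul_add]
    linarith
  · rw [hdomν]; linarith

theorem tiling {G : Type*} [Group G] (ham : IsAmenable G) {Y : Type*}
    [MeasurableSpace Y] [StandardBorelSpace Y]
    (ν : Measure Y) [IsProbabilityMeasure ν] [MulAction G Y]
    (hmp : ∀ g : G, MeasurePreserving (fun y : Y => g • y) ν ν)
    (hfree : ∀ (g : G) (y : Y), g • y = y → g = 1)
    (S : Finset G) (ε : ℝ) (hε : 0 < ε) :
    ∃ c : Y → G, (∀ q, MeasurableSet (c ⁻¹' {q})) ∧ (Set.range c).Finite ∧
      ∀ s ∈ S, ν.real {y | ¬ c (s⁻¹ • y) = c y * s} ≤ ε := by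
  classical
  obtain ⟨F, hFne, hF⟩ := folner ham (S ∪ S.image (·⁻¹)) (ε / 8 / (S.card + 1)) (by positivity)
  have hFw : ∑ g ∈ F, (((S.filter (fun s => g * s ∉ F)).card : ℝ) +
      ((S.filter (fun s => g * s⁻¹ ∉ F)).card : ℝ)) ≤ ε / 2 / 2 * F.card := by
    have gen : ∀ t : G → G, (∀ s ∈ S, t s ∈ S ∪ S.image (·⁻¹)) →
        ∑ g ∈ F, ((S.filter (fun s => g * t s ∉ F)).card : ℝ) ≤ ε / 8 * F.card := by
      intro t ht
      have h1 : ∑ g ∈ F, ((S.filter (fun s => g * t s ∉ F)).card : ℝ) =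
          ∑ s ∈ S, ((F.filter (fun g => g * t s ∉ F)).card : ℝ) := by
        simp only [Finset.card_filter, Nat.cast_sum]
        exact Finset.sum_comm
      rw [h1]
      refine (Finset.sum_le_sum fun s hs => hF (t s) (ht s hs)).trans ?_
      rw [Finset.sum_const, nsmul_eq_mul]
      have h2 : (S.card : ℝ) * (ε / 8 / (S.card + 1)) ≤ ε / 8 := by
        rw [mul_div_assoc', div_le_iff₀ (by positivity)]
        nlinarith
      rw [← mul_assoc]
      exact mul_le_mul_of_nonneg_right h2 (by positivity)
    rw [Finset.sum_add_distrib]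
    have e1 := gen id (fun s hs => Finset.mem_union_left _ hs)
    have e2 := gen (·⁻¹) (fun s hs => Finset.mem_union_right _ (Finset.mem_image_of_mem _ hs))
    simp only [id] at e1
    linarith
  obtain ⟨n, P, Pm, hP, hPν⟩ := coloring ν hmp hfree F (ε / 2 / 4) (by positivity)
  set κ : ℝ := ε / 2 / 4 / 2 ^ n with hκ
  have κ0 : 0 < κ := by positivity
  have ind : ∀ k : ℕ, ∃ c : Y → Option G, (∀ q, MeasurableSet (c ⁻¹' {q})) ∧
      (Set.range c).Finite ∧
      ∑ s ∈ S, ν.real (badE c s) ≤ ε / 2 * ν.real {y | c y ≠ none} ∧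
      (ν.real {y | c y = none} ≤ ε / 2 ∨ k * κ ≤ ν.real {y | c y ≠ none}) := by
    intro k
    induction k with
    | zero =>
      refine ⟨fun _ => none, fun q => measurable_const (MeasurableSpace.measurableSet_top (s := {q})),
        (Set.finite_singleton none).subset (by rintro _ ⟨y, rfl⟩; rfl), ?_, Or.inr (by simp)⟩
      simp [badE]
    | succ k ih =>
      obtain ⟨c, cm, cf, hc, h | h⟩ := ih
      · exact ⟨c, cm, cf, hc, Or.inl h⟩
      by_cases hA : ε / 2 ≤ ν.real {y | c y = none}
      · obtain ⟨c', cm', cf', hc', h'⟩ := extend ν hmp S F hFne (ε / 2) (by positivity) hFw n P Pm hP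
          (ε / 2) (by positivity) hPν c cm cf hc hA
        refine ⟨c', cm', cf', hc', Or.inr ?_⟩
        push_cast
        linarith
      · exact ⟨c, cm, cf, hc, Or.inl (not_le.1 hA).le⟩
  obtain ⟨k, hk⟩ := exists_nat_gt (1 / κ)
  obtain ⟨c, cm, cf, hc, h⟩ := ind k
  have hA : ν.real {y | c y = none} ≤ ε / 2 := by
    rcases h with h | h
    · exact h
    · rw [div_lt_iff₀ κ0] at hk
      have : ν.real {y | c y ≠ none} ≤ 1 := measureReal_le_one
      linarith
  refine ⟨fun y => (c y).getD 1, ?_, ?_, ?_⟩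
  · intro q
    have : (fun y => (c y).getD 1) ⁻¹' {q} =
        ⋃ o ∈ cf.toFinset.filter (fun o => o.getD 1 = q), c ⁻¹' {o} := by
      ext y; simp
    rw [this]
    exact Finset.measurableSet_biUnion _ fun o _ => cm o
  · refine (cf.image (fun o => o.getD 1)).subset ?_
    rintro _ ⟨y, rfl⟩
    exact ⟨c y, ⟨y, rfl⟩, rfl⟩
  · intro s hs
    have hsub : {y | ¬ (c (s⁻¹ • y)).getD 1 = (c y).getD 1 * s} ⊆ badE c s ∪ {y | c y = none} := by
      intro y hy
      by_cases h0 : c y = none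
      · exact Or.inr h0
      · left
        refine ⟨Or.inl h0, ?_⟩
        rintro ⟨q, h1, h2⟩
        apply hy
        simp [h1, h2]
    have h1 := measureReal_mono (μ := ν) hsub (measure_ne_top _ _)
    have h2 := measureReal_union_le (μ := ν) (badE c s) {y | c y = none}
    have h3 : ν.real (badE c s) ≤ ∑ s ∈ S, ν.real (badE c s) :=
      Finset.single_le_sum (f := fun s => ν.real (badE c s)) (fun _ _ => measureReal_nonneg) hs
    have h4 : ν.real {y | c y ≠ none} ≤ 1 := measureReal_le_one
    nlinarith

theorem tilingΓ (Γ : Type*) [Group Γ] (Λ : Subgroup Γ) [Λ.Normal]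
    (hamen : IsAmenable (Γ ⧸ Λ))
    (Y : Type*) [MeasurableSpace Y] [StandardBorelSpace Y]
    (ν : Measure Y) [IsProbabilityMeasure ν] (b : PMPAction Γ Y ν)
    (hstab : ∀ (y : Y) (γ : Γ), b.act γ y = y ↔ γ ∈ Λ)
    (S : Finset Γ) (ε : ℝ) (hε : 0 < ε) :
    ∃ c : Y → Γ ⧸ Λ, (∀ q, MeasurableSet (c ⁻¹' {q})) ∧ (Set.range c).Finite ∧
      ∀ s ∈ S, ν.real {y | ¬ c (b.act s⁻¹ y) = c y * (s : Γ ⧸ Λ)} ≤ ε := by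
  classical
  have hact : ∀ (γ δ : Γ) (y : Y), (γ : Γ ⧸ Λ) = δ → b.act γ y = b.act δ y := by
    intro γ δ y h
    have h1 := (hstab y _).2 (QuotientGroup.eq.1 h)
    have h2 := b.act_mul γ (γ⁻¹ * δ) y
    rw [mul_inv_cancel_left, h1] at h2
    exact h2.symm
  let _ : MulAction (Γ ⧸ Λ) Y :=
    { smul := fun q y => b.act q.out y
      one_smul := fun y => by
        change b.act (1 : Γ ⧸ Λ).out y = y
        rw [hact _ 1 y (by simp), b.act_one]
      mul_smul := fun q r y => by
        change b.act (q * r).out y = b.act q.out (b.act r.out y)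
        rw [← b.act_mul]
        exact hact _ _ y (by simp) }
  have hsm : ∀ (γ : Γ) (y : Y), (γ : Γ ⧸ Λ) • y = b.act γ y :=
    fun γ y => hact _ _ y (by simp)
  obtain ⟨c, cm, cf, hc⟩ := tiling hamen ν (fun q => b.measurePreserving q.out) (by
    intro q y h
    have := (hstab y q.out).1 h
    rw [← QuotientGroup.eq_one_iff] at this
    simpa using this) (S.image (fun s : Γ => (s : Γ ⧸ Λ))) ε hε
  refine ⟨c, cm, cf, fun s hs => ?_⟩
  have := hc s (Finset.mem_image_of_mem _ hs)
  simpa only [← QuotientGroup.mk_inv, hsm] using this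

set_option maxHeartbeats 1000000 in
theorem transfer {Γ : Type*} [Group Γ] {G : Type*} [Group G] (π : Γ →* G)
    {X Y : Type*} [MeasurableSpace X] [MeasurableSpace Y] (μ : Measure X)
    [IsProbabilityMeasure μ] (ν : Measure Y) [IsProbabilityMeasure ν]
    (a : PMPAction Γ X μ) (b : PMPAction Γ Y ν) (hwc : WeaklyContains a b)
    (S : Finset Γ) (c : Y → G) (cm : ∀ q, MeasurableSet (c ⁻¹' {q}))
    (cf : (Set.range c).Finite) (ε : ℝ) (hε : 0 < ε)
    (hc : ∀ s ∈ S, ν.real {y | ¬ c (b.act s⁻¹ y) = c y * π s} ≤ ε) :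
    ∃ c' : X → G, (∀ q, MeasurableSet (c' ⁻¹' {q})) ∧ (Set.range c').Finite ∧
      ∀ s ∈ S, μ.real {x | ¬ c' (a.act s⁻¹ x) = c' x * π s} ≤ 2 * ε := by
  classical
  set K := cf.toFinset with hK
  have hcK : ∀ y, c y ∈ K := fun y => by simp [hK]
  let e := K.equivFin
  set N : ℝ := (K.card : ℝ) with hN
  have N0 : 0 ≤ N := by positivity
  obtain ⟨η, η0, hη⟩ : ∃ η : ℝ, 0 < η ∧ N * η + N * (2 * (N ^ 2 * η)) ≤ ε := by
    refine ⟨ε / (N + 2 * N ^ 3 + 1), by positivity, ?_⟩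
    have : N * (ε / (N + 2 * N ^ 3 + 1)) + N * (2 * (N ^ 2 * (ε / (N + 2 * N ^ 3 + 1)))) =
        (N + 2 * N ^ 3) * ε / (N + 2 * N ^ 3 + 1) := by ring
    rw [this, div_le_iff₀ (by positivity)]
    linarith
  obtain ⟨A₀, A₀m, hA₀⟩ := hwc K.card (fun i => c ⁻¹' {((e.symm i : K) : G)}) (fun i => cm _)
    (insert 1 S) η η0
  let A : G → Set X := fun q => if h : q ∈ K then A₀ (e ⟨q, h⟩) else ∅
  have Am : ∀ q, MeasurableSet (A q) := by
    intro q
    by_cases h : q ∈ K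
    · simp only [A, dif_pos h]; exact A₀m _
    · simp only [A, dif_neg h]; exact MeasurableSet.empty
  have hA : ∀ s ∈ insert 1 S, ∀ q ∈ K, ∀ r ∈ K,
      |ν.real (b.act s⁻¹ ⁻¹' (c ⁻¹' {q}) ∩ c ⁻¹' {r}) - μ.real (a.act s⁻¹ ⁻¹' A q ∩ A r)| < η := by
    intro s hs q hq r hr
    have := hA₀ s hs (e ⟨q, hq⟩) (e ⟨r, hr⟩)
    simp only [Equiv.symm_apply_apply] at this
    simp only [A, dif_pos hq, dif_pos hr]
    exact this
  let Z : Set X := ⋃ p ∈ (K ×ˢ K).filter (fun p => p.1 ≠ p.2), A p.1 ∩ A p.2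
  have Zm : MeasurableSet Z := Finset.measurableSet_biUnion _ fun p _ => (Am _).inter (Am _)
  have hZ : μ.real Z ≤ N ^ 2 * η := by
    refine (measureReal_biUnion_finset_le _ _).trans ?_
    have h1 : ∀ p ∈ (K ×ˢ K).filter (fun p => p.1 ≠ p.2), μ.real (A p.1 ∩ A p.2) ≤ η := by
      rintro ⟨q, r⟩ hp
      rw [Finset.mem_filter, Finset.mem_product] at hp
      obtain ⟨⟨hq, hr⟩, hne⟩ := hp
      have h2 := hA 1 (Finset.mem_insert_self _ _) q hq r hr
      have h3 : b.act (1 : Γ)⁻¹ ⁻¹' (c ⁻¹' {q}) ∩ c ⁻¹' {r} = ∅ := by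
        ext y
        simp only [inv_one, Set.mem_inter_iff, Set.mem_preimage, b.act_one, Set.mem_singleton_iff,
          Set.mem_empty_iff_false, iff_false]
        rintro ⟨h4, h5⟩
        exact hne (h4.symm.trans h5)
      have h4 : a.act (1 : Γ)⁻¹ ⁻¹' A q = A q := by
        ext x
        simp only [inv_one, Set.mem_preimage, a.act_one]
      rw [h3, h4] at h2
      simp only [measureReal_empty, zero_sub, abs_neg] at h2
      exact (le_abs_self _).trans h2.le
    refine (Finset.sum_le_sum h1).trans ?_
    rw [Finset.sum_const, nsmul_eq_mul]
    refine mul_le_mul_of_nonneg_right ?_ η0.le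
    have := Finset.card_filter_le (K ×ˢ K) (fun p => p.1 ≠ p.2)
    rw [Finset.card_product] at this
    rw [pow_two, hN]
    exact_mod_cast this
  have hAu : ∀ x, x ∉ Z → ∀ q r, x ∈ A q → x ∈ A r → q = r := by
    intro x hx q r hq hr
    by_contra hne
    have mK : ∀ q, x ∈ A q → q ∈ K := by
      intro q hq
      by_contra h
      simp only [A, dif_neg h] at hq
      exact hq
    apply hx
    simp only [Z, Set.mem_iUnion]
    exact ⟨(q, r), Finset.mem_filter.2 ⟨Finset.mem_product.2 ⟨mK q hq, mK r hr⟩, hne⟩, hq, hr⟩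
  let o : X → Option G := fun x => if h : x ∉ Z ∧ ∃ q ∈ K, x ∈ A q then some h.2.choose else none
  have ho : ∀ x q, q ∈ K → (o x = some q ↔ x ∉ Z ∧ x ∈ A q) := by
    intro x q hq
    simp only [o]
    split_ifs with h
    · have h2 := h.2.choose_spec
      rw [Option.some_inj]
      constructor
      · intro h3; rw [← h3]; exact ⟨h.1, h2.2⟩
      · rintro ⟨h3, h4⟩; exact hAu x h3 _ _ h2.2 h4
    · simp only [false_iff]
      exact fun h3 => h ⟨h3.1, q, hq, h3.2⟩
  have hoK : ∀ x q, o x = some q → q ∈ K := by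
    intro x q h
    simp only [o] at h
    split_ifs at h with h1
    · rw [Option.some_inj] at h
      rw [← h]; exact h1.2.choose_spec.1
  have hosm : ∀ q, MeasurableSet (o ⁻¹' {some q}) := by
    intro q
    by_cases hq : q ∈ K
    · have : o ⁻¹' {some q} = Zᶜ ∩ A q := by
        ext x; exact ho x q hq
      rw [this]
      exact Zm.compl.inter (Am q)
    · have : o ⁻¹' {some q} = ∅ := by
        ext x
        simp only [Set.mem_preimage, Set.mem_singleton_iff, Set.mem_empty_iff_false, iff_false]
        exact fun h => hq (hoK x q h)
      rw [this]; exact MeasurableSet.empty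
  have honm : MeasurableSet (o ⁻¹' {none}) := by
    have : o ⁻¹' {none} = (⋃ q ∈ K, o ⁻¹' {some q})ᶜ := by
      ext x
      simp only [Set.mem_preimage, Set.mem_singleton_iff, Set.mem_compl_iff, Set.mem_iUnion,
        not_exists]
      constructor
      · intro h q _; simp [h]
      · intro h
        rcases hx : o x with _ | q
        · rfl
        · exact absurd hx (h q (hoK x q hx))
    rw [this]
    exact (Finset.measurableSet_biUnion _ fun q _ => hosm q).compl
  refine ⟨fun x => (o x).getD 1, ?_, ?_, ?_⟩
  · intro q
    by_cases hq : q = 1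
    · have : (fun x => (o x).getD 1) ⁻¹' {q} = o ⁻¹' {some q} ∪ o ⁻¹' {none} := by
        ext x
        rcases hx : o x with _ | r <;> simp [hx, hq]
      rw [this]; exact (hosm q).union honm
    · have : (fun x => (o x).getD 1) ⁻¹' {q} = o ⁻¹' {some q} := by
        ext x
        rcases hx : o x with _ | r <;> simp [hx, eq_comm]
        simpa [eq_comm] using hq
      rw [this]; exact hosm q
  · refine (K.finite_toSet.union (Set.finite_singleton 1)).subset ?_
    rintro _ ⟨x, rfl⟩
    rcases hx : o x with _ | r
    · right; simp [hx]
    · left; simpa [hx] using hoK x r hx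
  · intro s hs
    let L := K.filter (fun q => q * π s ∈ K)
    let sZ : Set X := a.act s⁻¹ ⁻¹' Z
    have sZm : MeasurableSet sZ := (a.measurePreserving _).measurable Zm
    have hsZ : μ.real sZ = μ.real Z :=
      (a.measurePreserving s⁻¹).measureReal_preimage Zm.nullMeasurableSet
    let W : G → Set X := fun q => (a.act s⁻¹ ⁻¹' A (q * π s) ∩ A q) \ (Z ∪ sZ)
    have Wm : ∀ q, MeasurableSet (W q) := fun q =>
      (((a.measurePreserving _).measurable (Am _)).inter (Am q)).diff (Zm.union sZm)
    have Wd : (L : Set G).PairwiseDisjoint W := by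
      intro q _ r _ hne
      rw [Function.onFun, Set.disjoint_left]
      intro x h1 h2
      exact hne (hAu x (fun h => h1.2 (Or.inl h)) q r h1.1.2 h2.1.2)
    let B : G → Set Y := fun q => b.act s⁻¹ ⁻¹' (c ⁻¹' {q * π s}) ∩ c ⁻¹' {q}
    have hW : ∀ q ∈ L, ν.real (B q) - η - 2 * (N ^ 2 * η) ≤ μ.real (W q) := by
      intro q hq
      obtain ⟨h1, h2⟩ := Finset.mem_filter.1 hq
      have h3 := (abs_lt.1 (hA s (Finset.mem_insert_of_mem hs) _ h2 q h1)).2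
      have h4 := le_measureReal_sdiff (μ := μ) (s₁ := a.act s⁻¹ ⁻¹' A (q * π s) ∩ A q)
        (s₂ := Z ∪ sZ)
      have h5 := measureReal_union_le (μ := μ) Z sZ
      change ν.real (B q) - _ < η at h3
      change _ ≤ μ.real (W q) at h4
      linarith
    have hgY : 1 - ε ≤ ∑ q ∈ L, ν.real (B q) := by
      have h1 : (Set.univ : Set Y) ⊆ {y | ¬ c (b.act s⁻¹ y) = c y * π s} ∪ ⋃ q ∈ L, B q := by
        intro y _
        by_cases h : c (b.act s⁻¹ y) = c y * π s
        · right
          simp only [Set.mem_iUnion]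
          refine ⟨c y, Finset.mem_filter.2 ⟨hcK y, ?_⟩, h, rfl⟩
          rw [← h]; exact hcK _
        · exact Or.inl h
      have h2 := measureReal_mono (μ := ν) h1 (measure_ne_top _ _)
      have h3 := measureReal_union_le (μ := ν) {y | ¬ c (b.act s⁻¹ y) = c y * π s} (⋃ q ∈ L, B q)
      have h4 := measureReal_biUnion_finset_le (μ := ν) L B
      have h5 := hc s hs
      rw [probReal_univ] at h2
      linarith
    have hWsum := Finset.sum_le_sum hW
    rw [Finset.sum_sub_distrib, Finset.sum_sub_distrib, Finset.sum_const, Finset.sum_const,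
      nsmul_eq_mul, nsmul_eq_mul, ← measureReal_biUnion_finset Wd fun q _ => Wm q] at hWsum
    have hLN : (L.card : ℝ) ≤ N := by
      rw [hN]; exact_mod_cast Finset.card_filter_le _ _
    have hL1 : (L.card : ℝ) * η ≤ N * η := mul_le_mul_of_nonneg_right hLN η0.le
    have hL2 : (L.card : ℝ) * (2 * (N ^ 2 * η)) ≤ N * (2 * (N ^ 2 * η)) :=
      mul_le_mul_of_nonneg_right hLN (by positivity)
    have hsub : {x | ¬ (o (a.act s⁻¹ x)).getD 1 = (o x).getD 1 * π s} ⊆ (⋃ q ∈ L, W q)ᶜ := by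
      intro x hx hx2
      simp only [Set.mem_iUnion] at hx2
      obtain ⟨q, hq, h1⟩ := hx2
      obtain ⟨h2, h3⟩ := Finset.mem_filter.1 hq
      apply hx
      rw [(ho x q h2).2 ⟨fun h => h1.2 (Or.inl h), h1.1.2⟩,
        (ho _ (q * π s) h3).2 ⟨fun h => h1.2 (Or.inr h), h1.1.1⟩]
      rfl
    have h1 := measureReal_mono (μ := μ) hsub (measure_ne_top _ _)
    rw [probReal_compl_eq_one_sub (Finset.measurableSet_biUnion _ fun q _ => Wm q)] at h1
    linarith

/-- Let `Λ ◁ Γ` with `Γ/Λ` amenable, and let `Γ ↷ᵃ (X, μ)` weakly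
contain a p.m.p. action `Γ ↷ᵇ (Y, ν)` on a standard Borel probability space in which every
point has stabilizer exactly `Λ`.  Then for every finite `S ⊆ Γ` containing the identity
and every `ε > 0` there is a measurable map `c : X → Γ/Λ` with finite image such that
`μ({x : c(s⁻¹·x) = c(x)·s for all s ∈ S}) > 1 − ε`. -/
theorem stmt14 (Γ : Type*) [Group Γ] [Countable Γ] (Λ : Subgroup Γ) [Λ.Normal]
    (hamen : IsAmenable (Γ ⧸ Λ))
    (X : Type*) [MeasurableSpace X] (μ : Measure X) [IsProbabilityMeasure μ]
    (Y : Type*) [MeasurableSpace Y] [StandardBorelSpace Y]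
    (ν : Measure Y) [IsProbabilityMeasure ν]
    (a : PMPAction Γ X μ) (b : PMPAction Γ Y ν)
    (hwc : WeaklyContains a b)
    (hstab : ∀ (y : Y) (γ : Γ), b.act γ y = y ↔ γ ∈ Λ) :
    ∀ S : Finset Γ, (1 : Γ) ∈ S → ∀ ε : ℝ, 0 < ε →
      ∃ c : X → Γ ⧸ Λ,
        (∀ q : Γ ⧸ Λ, MeasurableSet (c ⁻¹' {q})) ∧
        (Set.range c).Finite ∧
        1 - ε < (μ {x : X | ∀ s ∈ S, c (a.act s⁻¹ x) = c x * (s : Γ ⧸ Λ)}).toReal := by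
  intro S _ ε hε
  classical
  obtain ⟨c, cm, cf, hc⟩ := tilingΓ Γ Λ hamen Y ν b hstab S (ε / 2 / (S.card + 1)) (by positivity)
  obtain ⟨c', cm', cf', hc'⟩ := transfer (QuotientGroup.mk' Λ) μ ν a b hwc S c cm cf
    (ε / 2 / (S.card + 1)) (by positivity) hc
  refine ⟨c', cm', cf', ?_⟩
  have hsub : (Set.univ : Set X) ⊆ {x : X | ∀ s ∈ S, c' (a.act s⁻¹ x) = c' x * (s : Γ ⧸ Λ)} ∪
      ⋃ s ∈ S, {x | ¬ c' (a.act s⁻¹ x) = c' x * QuotientGroup.mk' Λ s} := by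
    intro x _
    by_cases h : ∀ s ∈ S, c' (a.act s⁻¹ x) = c' x * (s : Γ ⧸ Λ)
    · exact Or.inl h
    · right
      push Not at h
      obtain ⟨s, hs, h⟩ := h
      simp only [Set.mem_iUnion]
      exact ⟨s, hs, h⟩
  have h1 := measureReal_mono (μ := μ) hsub (measure_ne_top _ _)
  rw [probReal_univ] at h1
  have h2 := h1.trans (measureReal_union_le _ _)
  have h3 := (measureReal_biUnion_finset_le (μ := μ) S
    (fun s => {x | ¬ c' (a.act s⁻¹ x) = c' x * QuotientGroup.mk' Λ s})).trans
      (Finset.sum_le_sum hc')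
  rw [Finset.sum_const, nsmul_eq_mul] at h3
  have h4 : (S.card : ℝ) * (2 * (ε / 2 / (S.card + 1))) < ε := by
    have : (S.card : ℝ) * (2 * (ε / 2 / (S.card + 1))) = S.card * ε / (S.card + 1) := by
      field_simp
    rw [this, div_lt_iff₀ (by positivity)]
    nlinarith
  change 1 - ε < μ.real _
  linarith

end Stmt14
end
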